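/- Suppose f : ℝ → ℝ is convex and differentiable on [0,1] and Lipschitz on [0,1], with f(0) ≥ 0, f(1) = 0 and f'(1) = γ > 0. Let u be the [0,1]-valued mild solution of ∂u/∂t = 𝓛u + f(u) with Heaviside initial condition u_0(x) = 1_{x ≥ 0}. Then for every θ > 0 at which Λ(θ) is finite, every r ∈ ℝ and every t ≥ 0: 1 − u(t, rt) ≤ e^{ t( Λ(θ) + γ − rθ ) }. In particular, if r > (Λ(θ) + γ)/θ for some θ > 0 then 1 − u(t, rt) → 0 as t → ∞. -/

import Mathlib

open MeasureTheory Filter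

/-- A mild solution of `∂u/∂t = 𝓛u + f(u)` on `ℝ`, where `𝓛` generates the Lévy
semigroup of kernels `(P_t φ)(x) = ∫ φ(x - y) dν_t(y)` associated with the convolution
semigroup `ν`. -/
def IsMildSolutionConv (ν : ℝ → Measure ℝ) (f : ℝ → ℝ) (u₀ : ℝ → ℝ)
    (u : ℝ → ℝ → ℝ) : Prop :=
  Measurable (Function.uncurry u) ∧ (∀ x, u 0 x = u₀ x) ∧
    ∀ t ≥ (0:ℝ), ∀ x, u t x = (∫ y, u₀ (x - y) ∂(ν t)) +
      ∫ s in (0:ℝ)..t, ∫ y, f (u (t - s) (x - y)) ∂(ν s)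

/-- Measurable solutions of Cauchy's functional equation on the half-line are linear. -/
lemma eq_mul_of_measurable_of_add {g : ℝ → ℝ} (hg : Measurable g)
    (hadd : ∀ s ≥ (0 : ℝ), ∀ t ≥ (0 : ℝ), g (s + t) = g s + g t) {t : ℝ} (ht : 0 ≤ t) :
    g t = t * g 1 := by
  have hg0 : g 0 = 0 := by simpa using hadd 0 le_rfl 0 le_rfl
  have key : ∀ p ≥ (0 : ℝ), ∀ q ≥ (0 : ℝ),
      g (max (p - q) 0) - g (max (-(p - q)) 0) = g p - g q := by
    intro p hp q hq
    rcases le_total p q with h | h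
    · rw [max_eq_right (by linarith), max_eq_left (by linarith)]
      have := hadd (-(p - q)) (by linarith) p hp
      rw [show -(p - q) + p = q by ring] at this
      linarith
    · rw [max_eq_left (by linarith), max_eq_right (by linarith)]
      have := hadd (p - q) (by linarith) q hq
      rw [sub_add_cancel] at this
      linarith
  let G : ℝ →+ ℝ := AddMonoidHom.mk' (fun x => g (max x 0) - g (max (-x) 0)) (by
    intro x y
    have hx : max x 0 - max (-x) 0 = x := by
      rcases le_total x 0 with h | h <;> simp [h]
    have hy : max y 0 - max (-y) 0 = y := by
      rcases le_total y 0 with h | h <;> simp [h]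
    have h := key (max x 0 + max y 0) (by positivity) (max (-x) 0 + max (-y) 0) (by positivity)
    rw [show max x 0 + max y 0 - (max (-x) 0 + max (-y) 0) = x + y by linarith,
      hadd _ (le_max_right _ _) _ (le_max_right _ _),
      hadd _ (le_max_right _ _) _ (le_max_right _ _)] at h
    linarith)
  have hGval : ∀ x ≥ (0 : ℝ), G x = g x := by
    intro x hx
    have : G x = g (max x 0) - g (max (-x) 0) := rfl
    rw [this, max_eq_left hx, max_eq_right (by linarith), hg0, sub_zero]
  have hGmeas : Measurable G :=
    (hg.comp (by fun_prop)).sub (hg.comp (by fun_prop))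
  have h := map_real_smul G (MeasureTheory.Measure.AddMonoidHom.continuous_of_measurable G hGmeas) t 1
  rwa [smul_eq_mul, mul_one, smul_eq_mul, hGval t ht, hGval 1 zero_le_one] at h

/-- A finite exponential moment of a measurable convolution semigroup at time `1` is finite at
all times, and depends exponentially on time. -/
lemma integrable_exp_and_integral_exp_of_convolution_semigroup
    {ν : ℝ → Measure ℝ} [∀ t, IsProbabilityMeasure (ν t)]
    (hνsemi : ∀ s ≥ (0 : ℝ), ∀ t ≥ (0 : ℝ), ν (s + t) = (ν s).conv (ν t))
    (hνmeas : Measurable ν) {θ : ℝ} (hθ : Integrable (fun y => Real.exp (θ * y)) (ν 1))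
    {t : ℝ} (ht : 0 ≤ t) :
    Integrable (fun y => Real.exp (θ * y)) (ν t) ∧
      ∫ y, Real.exp (θ * y) ∂(ν t) = Real.exp (t * Real.log (∫ y, Real.exp (θ * y) ∂(ν 1))) := by
  set M : ℝ → ENNReal := fun t => ∫⁻ y, ENNReal.ofReal (Real.exp (θ * y)) ∂(ν t) with hM
  have hmeas : Measurable fun y : ℝ => ENNReal.ofReal (Real.exp (θ * y)) := by fun_prop
  have hMmeas : Measurable M := (Measure.measurable_lintegral hmeas).comp hνmeas
  have hMadd : ∀ s ≥ (0 : ℝ), ∀ t ≥ (0 : ℝ), M (s + t) = M s * M t := by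
    intro s hs t ht
    simp only [hM]
    rw [hνsemi s hs t ht, Measure.lintegral_conv hmeas, ← lintegral_mul_const _ hmeas]
    refine lintegral_congr fun x => ?_
    rw [← lintegral_const_mul _ hmeas]
    refine lintegral_congr fun y => ?_
    rw [mul_add, Real.exp_add, ENNReal.ofReal_mul (Real.exp_pos _).le]
  have hMpos : ∀ t, M t ≠ 0 := by
    intro t h
    rw [hM, lintegral_eq_zero_iff hmeas] at h
    obtain ⟨y, hy⟩ := h.exists
    simp only [Pi.zero_apply, ENNReal.ofReal_eq_zero] at hy
    exact absurd hy (not_le.mpr (Real.exp_pos _))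
  have hint : ∀ t, M t ≠ ⊤ → Integrable (fun y => Real.exp (θ * y)) (ν t) := fun t h =>
    (lintegral_ofReal_ne_top_iff_integrable (by fun_prop)
      (ae_of_all _ fun y => (Real.exp_pos _).le)).mp h
  have hM1 : M 1 ≠ ⊤ := (lintegral_ofReal_ne_top_iff_integrable (by fun_prop)
      (ae_of_all _ fun y => (Real.exp_pos _).le)).mpr hθ
  have hMnat : ∀ n : ℕ, M (n + 1) ≠ ⊤ := by
    intro n
    induction n with
    | zero => simpa using hM1
    | succ n ih =>
      rw [hMadd _ (by positivity) 1 zero_le_one]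
      push_cast
      exact ENNReal.mul_ne_top ih hM1
  have hMtop : ∀ t ≥ (0 : ℝ), M t ≠ ⊤ := by
    intro t ht h
    obtain ⟨n, hn⟩ := exists_nat_ge t
    refine hMnat n ?_
    have := hMadd t ht (n + 1 - t) (by linarith)
    rw [add_sub_cancel] at this
    rw [this, h, ENNReal.top_mul (hMpos _)]
  have hval : ∀ t, ∫ y, Real.exp (θ * y) ∂(ν t) = (M t).toReal := fun t =>
    integral_eq_lintegral_of_nonneg_ae (ae_of_all _ fun y => (Real.exp_pos _).le) (by fun_prop)
  have hlin := eq_mul_of_measurable_of_add (g := fun t => Real.log (M t).toReal)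
    (by fun_prop) (by
      intro s hs t ht
      rw [hMadd s hs t ht, ENNReal.toReal_mul, Real.log_mul]
      · exact (ENNReal.toReal_pos (hMpos s) (hMtop s hs)).ne'
      · exact (ENNReal.toReal_pos (hMpos t) (hMtop t ht)).ne') ht
  refine ⟨hint t (hMtop t ht), ?_⟩
  rw [hval, hval, ← hlin, Real.exp_log (ENNReal.toReal_pos (hMpos t) (hMtop t ht))]

/-- Comparison of integrals in which only the nonnegative upper bound has to be integrable. -/
lemma integral_le_integral_of_le_of_nonneg {α : Type*} [MeasurableSpace α] {μ : Measure α}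
    {g h : α → ℝ} (hh : Integrable h μ) (h0 : 0 ≤ᵐ[μ] h) (hgh : g ≤ᵐ[μ] h) :
    ∫ a, g a ∂μ ≤ ∫ a, h a ∂μ := by
  by_cases hg : Integrable g μ
  · exact integral_mono_ae hg hh hgh
  · rw [integral_undef hg]
    exact integral_nonneg_of_ae h0

/-- A convex function on `[0,1]` vanishing at `1` lies above its tangent there. -/
lemma neg_le_mul_one_sub_of_convexOn {f : ℝ → ℝ} {γ : ℝ} (hf : ConvexOn ℝ (Set.Icc 0 1) f)
    (hf1 : f 1 = 0) (hγ : HasDerivWithinAt f γ (Set.Icc 0 1) 1) {w : ℝ}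
    (hw : w ∈ Set.Icc (0 : ℝ) 1) : -f w ≤ γ * (1 - w) := by
  rcases hw.2.eq_or_lt with rfl | h
  · simp [hf1]
  · have hs := hf.slope_le_of_hasDerivWithinAt hw (Set.right_mem_Icc.mpr zero_le_one) h hγ
    rw [slope_def_field, hf1, div_le_iff₀ (by linarith)] at hs
    linarith

/-- The Heaviside function propagated by a probability measure has the exponential tail of
Chernoff's bound. -/
lemma one_sub_integral_heaviside_le {μ : Measure ℝ} [IsProbabilityMeasure μ] {θ : ℝ}
    (hθ : 0 < θ) (hint : Integrable (fun y => Real.exp (θ * y)) μ) (x : ℝ) :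
    1 - ∫ y, (if 0 ≤ x - y then (1 : ℝ) else 0) ∂μ ≤
      Real.exp (-(θ * x)) * ∫ y, Real.exp (θ * y) ∂μ := by
  have hmeas : Measurable fun y : ℝ => if 0 ≤ x - y then (1 : ℝ) else 0 :=
    Measurable.ite (measurableSet_le (by fun_prop) (by fun_prop)) (by fun_prop) (by fun_prop)
  have hi : Integrable (fun y : ℝ => if 0 ≤ x - y then (1 : ℝ) else 0) μ :=
    Integrable.of_bound hmeas.aestronglyMeasurable 1 (ae_of_all _ fun y => by
      split_ifs <;> simp)
  calc 1 - ∫ y, (if 0 ≤ x - y then (1 : ℝ) else 0) ∂μ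
      = ∫ y, (1 - if 0 ≤ x - y then (1 : ℝ) else 0) ∂μ := by
        rw [integral_sub (integrable_const _) hi]; simp
    _ ≤ ∫ y, Real.exp (-(θ * x)) * Real.exp (θ * y) ∂μ := by
        refine integral_mono ((integrable_const _).sub hi) (hint.const_mul _) fun y => ?_
        simp only
        rw [← Real.exp_add]
        split_ifs with h
        · simpa using (Real.exp_pos _).le
        · rw [sub_zero]
          refine Real.one_le_exp ?_
          nlinarith
    _ = _ := integral_const_mul _ _

/-- Picard-type iteration of the linearised Duhamel inequality for `1 - u`. -/
lemma one_sub_le_exp_add_pow_div_factorial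
    {ν : ℝ → Measure ℝ} [∀ t, IsProbabilityMeasure (ν t)] {f : ℝ → ℝ} {u : ℝ → ℝ → ℝ}
    {γ θ lam : ℝ} (hγpos : 0 < γ) (hθ : 0 < θ)
    (hexp : ∀ t ≥ (0 : ℝ), Integrable (fun y => Real.exp (θ * y)) (ν t) ∧
      ∫ y, Real.exp (θ * y) ∂(ν t) = Real.exp (t * lam))
    (hf : ∀ w ∈ Set.Icc (0 : ℝ) 1, -f w ≤ γ * (1 - w))
    (hu : IsMildSolutionConv ν f (fun x => if 0 ≤ x then (1 : ℝ) else 0) u)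
    (hu01 : ∀ t ≥ (0 : ℝ), ∀ x, u t x ∈ Set.Icc (0 : ℝ) 1) (n : ℕ) :
    ∀ t ≥ (0 : ℝ), ∀ x, 1 - u t x ≤
      Real.exp (-(θ * x)) * Real.exp (t * (lam + γ)) + (γ * t) ^ n / n.factorial := by
  induction n with
  | zero =>
    intro t ht x
    have := (hu01 t ht x).1
    have := mul_pos (Real.exp_pos (-(θ * x))) (Real.exp_pos (t * (lam + γ)))
    simp only [pow_zero, Nat.factorial_zero, Nat.cast_one, div_one]
    linarith
  | succ n ih =>
    intro t ht x
    set A := Real.exp (-(θ * x)) * Real.exp (t * lam) with hA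
    have hApos : 0 < A := by positivity
    have hinner : ∀ s ∈ Set.Ioc (0 : ℝ) t, -∫ y, f (u (t - s) (x - y)) ∂(ν s) ≤
        A * (γ * Real.exp (γ * (t - s))) + γ * ((γ * (t - s)) ^ n / n.factorial) := by
      intro s hs
      have hts : 0 ≤ t - s := by linarith [hs.2]
      obtain ⟨hi, hv⟩ := hexp s hs.1.le
      set B := γ * Real.exp (-(θ * x)) * Real.exp ((t - s) * (lam + γ)) with hB
      set C := γ * ((γ * (t - s)) ^ n / n.factorial) with hC
      have hB0 : 0 ≤ B := by positivity
      have hC0 : 0 ≤ C := by positivity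
      rw [← integral_neg]
      calc ∫ y, -f (u (t - s) (x - y)) ∂(ν s) ≤ ∫ y, (B * Real.exp (θ * y) + C) ∂(ν s) := by
            refine integral_le_integral_of_le_of_nonneg
              ((hi.const_mul B).add (integrable_const C))
              (ae_of_all _ fun y => by simp only [Pi.zero_apply]; positivity)
              (ae_of_all _ fun y => ?_)
            refine (hf _ (hu01 _ hts _)).trans
              ((mul_le_mul_of_nonneg_left (ih _ hts (x - y)) hγpos.le).trans_eq ?_)
            rw [show -(θ * (x - y)) = -(θ * x) + θ * y by ring, Real.exp_add]
            ring
        _ = B * Real.exp (s * lam) + C := by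
            rw [integral_add (hi.const_mul B) (integrable_const C), integral_const_mul, hv]
            simp
        _ = _ := by
            rw [hB, hA, show (t - s) * (lam + γ) = (t - s) * lam + γ * (t - s) by ring,
              Real.exp_add, show t * lam = (t - s) * lam + s * lam by ring, Real.exp_add]
            ring
    have hderiv : ∀ s ∈ Set.uIcc (0 : ℝ) t, HasDerivAt
        (fun s => -(A * Real.exp (γ * (t - s)) + (γ * (t - s)) ^ (n + 1) / (n + 1).factorial))
        (A * (γ * Real.exp (γ * (t - s))) + γ * ((γ * (t - s)) ^ n / n.factorial)) s := by
      intro s _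
      have h1 : HasDerivAt (fun s => γ * (t - s)) (γ * (-1)) s :=
        ((hasDerivAt_id s).const_sub t).const_mul γ
      refine ((h1.exp.const_mul A).add
        ((h1.pow (n + 1)).div_const ((n + 1).factorial : ℝ))).neg.congr_deriv ?_
      rw [Nat.factorial_succ]
      have : (n.factorial : ℝ) ≠ 0 := by positivity
      push_cast
      field_simp
      simp
      ring
    have hcont : Continuous fun s : ℝ =>
        A * (γ * Real.exp (γ * (t - s))) + γ * ((γ * (t - s)) ^ n / n.factorial) := by
      fun_prop
    have houter : -∫ s in (0 : ℝ)..t, ∫ y, f (u (t - s) (x - y)) ∂(ν s) ≤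
        A * Real.exp (γ * t) - A + (γ * t) ^ (n + 1) / (n + 1).factorial := by
      rw [← intervalIntegral.integral_neg]
      calc ∫ s in (0 : ℝ)..t, -∫ y, f (u (t - s) (x - y)) ∂(ν s)
          ≤ ∫ s in (0 : ℝ)..t,
            (A * (γ * Real.exp (γ * (t - s))) + γ * ((γ * (t - s)) ^ n / n.factorial)) := by
            rw [intervalIntegral.integral_of_le ht, intervalIntegral.integral_of_le ht]
            refine integral_le_integral_of_le_of_nonneg
              ((hcont.intervalIntegrable 0 t).1)
              ?_ ((ae_restrict_iff' measurableSet_Ioc).mpr (ae_of_all _ hinner))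
            refine (ae_restrict_iff' measurableSet_Ioc).mpr (ae_of_all _ fun s hs => ?_)
            have hts : 0 ≤ t - s := by linarith [hs.2]
            simp only [Pi.zero_apply]
            positivity
        _ = _ := by
            rw [intervalIntegral.integral_eq_sub_of_hasDerivAt hderiv
              (hcont.intervalIntegrable 0 t)]
            simp
            ring
    have h0 := one_sub_integral_heaviside_le hθ (hexp t ht).1 x
    rw [(hexp t ht).2] at h0
    have hsplit : Real.exp (-(θ * x)) * Real.exp (t * (lam + γ)) = A * Real.exp (γ * t) := by
      rw [hA, show t * (lam + γ) = t * lam + γ * t by ring, Real.exp_add]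
      ring
    rw [hu.2.2 t ht x, hsplit]
    linarith

/-- the upper bound of the wavefront proposition.  Let `u` be the
`[0,1]`-valued mild solution of `∂u/∂t = 𝓛u + f(u)` with Heaviside initial condition,
where `f` is convex, differentiable and Lipschitz on `[0,1]` with `f(0) ≥ 0`, `f(1) = 0`
and `f'(1) = γ > 0`.  Then for every `θ > 0` at which the cumulant generating function
`Λ` is finite, every `r` and every `t ≥ 0`, `1 - u(t, rt) ≤ e^{t(Λ(θ)+γ-rθ)}`; in
particular `1 - u(t, rt) → 0` as `t → ∞` whenever `r > (Λ(θ)+γ)/θ` for some `θ > 0`. -/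
theorem mild_solution_upper_tail_bound
    (ν : ℝ → Measure ℝ) [∀ t, IsProbabilityMeasure (ν t)]
    (hν0 : ν 0 = Measure.dirac 0)
    (hνsemi : ∀ s ≥ (0:ℝ), ∀ t ≥ (0:ℝ), ν (s + t) = (ν s).conv (ν t))
    (hνmeas : Measurable ν)
    (hΛfin : ∃ ε > (0:ℝ), ∀ θ : ℝ, |θ| < ε →
      Integrable (fun y => Real.exp (θ * y)) (ν 1))
    (f : ℝ → ℝ)
    (hfconv : ConvexOn ℝ (Set.Icc 0 1) f)
    (hfdiff : DifferentiableOn ℝ f (Set.Icc 0 1))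
    (hfLip : ∃ L : NNReal, LipschitzOnWith L f (Set.Icc 0 1))
    (hf0 : 0 ≤ f 0) (hf1 : f 1 = 0)
    (γ : ℝ) (hγ : HasDerivWithinAt f γ (Set.Icc 0 1) 1) (hγpos : 0 < γ)
    (u : ℝ → ℝ → ℝ)
    (hu : IsMildSolutionConv ν f (fun x => if 0 ≤ x then (1:ℝ) else 0) u)
    (hu01 : ∀ t ≥ (0:ℝ), ∀ x, u t x ∈ Set.Icc (0:ℝ) 1) :
    ∀ θ > (0:ℝ), Integrable (fun y => Real.exp (θ * y)) (ν 1) →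
      (∀ r : ℝ, ∀ t ≥ (0:ℝ), 1 - u t (r * t) ≤
        Real.exp (t * (Real.log (∫ y, Real.exp (θ * y) ∂(ν 1)) + γ - r * θ))) ∧
      (∀ r : ℝ, (Real.log (∫ y, Real.exp (θ * y) ∂(ν 1)) + γ) / θ < r →
        Tendsto (fun t => 1 - u t (r * t)) atTop (nhds 0)) := by
  intro θ hθ hint
  have hbound : ∀ t ≥ (0 : ℝ), ∀ x, 1 - u t x ≤ Real.exp (-(θ * x)) *
      Real.exp (t * (Real.log (∫ y, Real.exp (θ * y) ∂(ν 1)) + γ)) := by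
    intro t ht x
    have hlim := (tendsto_const_nhds (x := Real.exp (-(θ * x)) *
      Real.exp (t * (Real.log (∫ y, Real.exp (θ * y) ∂(ν 1)) + γ)))).add
      (FloorSemiring.tendsto_pow_div_factorial_atTop (γ * t))
    rw [add_zero] at hlim
    exact ge_of_tendsto' hlim fun n => one_sub_le_exp_add_pow_div_factorial hγpos hθ
      (fun t ht => integrable_exp_and_integral_exp_of_convolution_semigroup hνsemi hνmeas hint ht)
      (fun w hw => neg_le_mul_one_sub_of_convexOn hfconv hf1 hγ hw) hu hu01 n t ht x
  have hray : ∀ r : ℝ, ∀ t ≥ (0 : ℝ), 1 - u t (r * t) ≤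
      Real.exp (t * (Real.log (∫ y, Real.exp (θ * y) ∂(ν 1)) + γ - r * θ)) := by
    intro r t ht
    refine (hbound t ht (r * t)).trans_eq ?_
    rw [← Real.exp_add]
    ring_nf
  refine ⟨hray, fun r hr => ?_⟩
  rw [div_lt_iff₀ hθ] at hr
  refine tendsto_of_tendsto_of_tendsto_of_le_of_le' tendsto_const_nhds
    (Real.tendsto_exp_atBot.comp (tendsto_id.atTop_mul_const_of_neg (sub_neg.mpr hr))) ?_ ?_
  · filter_upwards [eventually_ge_atTop 0] with t ht
    linarith [(hu01 t ht (r * t)).2]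
  · filter_upwards [eventually_ge_atTop 0] with t ht
    exact hray r t ht
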